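/- arXiv:math/0210138 — 5 statements merged into one kernel-verified Lean document; each statement's English description precedes it below -/
import Mathlib

section
/- Let k be an algebraically closed field, let m ≥ 1, and let g = t^m + b₁t^{m−1} + ⋯ + b_{m−1}t + b_m ∈ k[t] be monic of degree m with constant coefficient b_m = g(0) ≠ 0. Let f ∈ k[t] be divisible by t². Then for every κ ∈ k with κ ≠ 0 and f − κ·g ≠ 0, all roots of f − κ·g are nonzero and the sum, over the multiset of roots α of f − κ·g counted with multiplicity, of the inverses α⁻¹ equals −b_{m−1}/b_m, where b_{m−1} is the coefficient of t in g. In particular this sum is independent of κ. -/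
open Polynomial

/-- The inverses of the roots of a split polynomial with nonzero constant coefficient sum to minus
the ratio of its linear coefficient to its constant coefficient. -/
theorem Polynomial.Splits.sum_inv_roots {k : Type*} [Field k] {p : k[X]} (hp : p.Splits)
    (h0 : p.coeff 0 ≠ 0) :
    (p.roots.map fun α => α⁻¹).sum = -(p.coeff 1) / p.coeff 0 := by
  have h := hp.eval_derivative_div_eval_of_ne_zero (x := 0) (by rwa [← coeff_zero_eq_eval_zero])
  rw [← coeff_zero_eq_eval_zero, ← coeff_zero_eq_eval_zero, coeff_derivative] at h
  simp only [zero_add, Nat.cast_zero, mul_one, zero_sub, one_div, inv_neg,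
    Multiset.sum_map_neg] at h
  rw [neg_div, h, neg_neg]

/-- For `g` monic of degree `m ≥ 1` with `g(0) ≠ 0`, `f` divisible by `t²`, and any
`κ ≠ 0` with `f - κ·g ≠ 0`, all roots of `f - κ·g` are nonzero and the sum of the
inverses of its roots (with multiplicity) is `-b_{m-1}/b_m`, independently of `κ`. -/
theorem stmt_0 {k : Type*} [Field k] [IsAlgClosed k] (m : ℕ) (hm : 1 ≤ m)
    (g f : k[X]) (hmonic : g.Monic) (hdeg : g.natDegree = m)
    (hb : g.coeff 0 ≠ 0) (hf : (X : k[X]) ^ 2 ∣ f)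
    (κ : k) (hκ : κ ≠ 0) (hne : f - C κ * g ≠ 0) :
    (∀ α ∈ (f - C κ * g).roots, α ≠ 0) ∧
      ((f - C κ * g).roots.map fun α => α⁻¹).sum = -(g.coeff 1) / g.coeff 0 := by
  obtain ⟨q, rfl⟩ := hf
  have h0 : (X ^ 2 * q - C κ * g).coeff 0 = -(κ * g.coeff 0) := by
    simp
  have h1 : (X ^ 2 * q - C κ * g).coeff 1 = -(κ * g.coeff 1) := by
    simp [coeff_X_pow_mul']
  have h0ne : (X ^ 2 * q - C κ * g).coeff 0 ≠ 0 := by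
    rw [h0]
    exact neg_ne_zero.mpr (mul_ne_zero hκ hb)
  refine ⟨?_, ?_⟩
  · rintro α hα rfl
    exact h0ne ((coeff_zero_eq_eval_zero _).trans (isRoot_of_mem_roots hα))
  · rw [(IsAlgClosed.splits _).sum_inv_roots h0ne, h0, h1]
    field_simp
end

section
/- Let k be a field of characteristic ≠ 2 and a ∈ k with a ≠ 0 and a ≠ 1. Then in k ⊗ kˣ one has the identity a ⊗ a + (1−a) ⊗ (1−a) = (−1) ⊗ a⁻¹ + (1−a) ⊗ (1 − a⁻¹); equivalently, ε(a) = −(a⋆ε(a⁻¹)). (This is the identity in k ⊗ kˣ underlying Lemma 3.6: ⟨a⟩ = −a⋆⟨a⁻¹⟩ in TB₂(k).) -/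
open TensorProduct

/-- In `k ⊗ kˣ`, elementary tensors with `-1` vanish as soon as `2` is invertible in `k`. -/
theorem tmul_ofMul_neg_one {k : Type*} [Field k] (h2 : (2 : k) ≠ 0) (x : k) :
    x ⊗ₜ[ℤ] Additive.ofMul (-1 : kˣ) = 0 := by
  have hx : x = (2 : ℤ) • (x / 2) := by
    rw [zsmul_eq_mul, Int.cast_ofNat, mul_div_cancel₀ x h2]
  have hu : (2 : ℤ) • Additive.ofMul (-1 : kˣ) = 0 := by
    rw [← ofMul_zpow, show (-1 : kˣ) ^ (2 : ℤ) = 1 from Even.neg_one_zpow even_two, ofMul_one]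
  rw [hx, TensorProduct.smul_tmul, hu, TensorProduct.tmul_zero]

/-- The identity `a ⊗ a + (1−a) ⊗ (1−a) = (−1) ⊗ a⁻¹ + (1−a) ⊗ (1 − a⁻¹)` in `k ⊗ kˣ`
(underlying Lemma 3.6: `⟨a⟩ = −a⋆⟨a⁻¹⟩`). -/
theorem stmt_4 {k : Type*} [Field k] (h2 : (2 : k) ≠ 0) (a : k) (ha0 : a ≠ 0) (ha1 : a ≠ 1) :
    (a ⊗ₜ[ℤ] Additive.ofMul (Units.mk0 a ha0)
        + (1 - a) ⊗ₜ[ℤ] Additive.ofMul (Units.mk0 (1 - a) (sub_ne_zero.mpr (Ne.symm ha1)))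
      : TensorProduct ℤ k (Additive kˣ))
    = (-1 : k) ⊗ₜ[ℤ] Additive.ofMul (Units.mk0 a⁻¹ (inv_ne_zero ha0))
        + (1 - a) ⊗ₜ[ℤ] Additive.ofMul
            (Units.mk0 (1 - a⁻¹) (sub_ne_zero.mpr fun h => ha1 (inv_eq_one.mp h.symm))) := by
  have hinv : Units.mk0 a⁻¹ (inv_ne_zero ha0) = (Units.mk0 a ha0)⁻¹ := by
    ext
    simp
  have hsub : Units.mk0 (1 - a⁻¹) (sub_ne_zero.mpr fun h => ha1 (inv_eq_one.mp h.symm))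
      = Units.mk0 (1 - a) (sub_ne_zero.mpr (Ne.symm ha1)) * (-1) * (Units.mk0 a ha0)⁻¹ := by
    ext
    simp only [Units.val_mk0, Units.val_mul, Units.val_neg, Units.val_one, Units.val_inv_eq_inv_val]
    field_simp
    ring
  rw [hinv, hsub]
  simp only [ofMul_mul, ofMul_inv, TensorProduct.tmul_add, TensorProduct.tmul_neg,
    TensorProduct.neg_tmul, tmul_ofMul_neg_one h2, TensorProduct.sub_tmul]
  abel
end

section
/- Let k be a field of characteristic ≠ 2 and let a, b ∈ k with a ≠ 0, a ≠ 1, b ≠ 0, b ≠ 1 and a ≠ b. Then in k ⊗ kˣ the Cathelineau elements satisfy the infinitesimal four-term relation ε(a) − ε(b) + a⋆ε(b/a) + (1−a)⋆ε((1−b)/(1−a)) = 0. (This is the image under the boundary map ∂ : TB₂(k) → k ⊗ kˣ of the relation ⟨a⟩ − ⟨b⟩ + a⋆⟨b/a⟩ + (1−a)⋆⟨(1−b)/(1−a)⟩ = 0 of Theorem 3.4, i.e., Cathelineau's infinitesimal version of the five-term dilogarithm relation.) -/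
open TensorProduct

/-- The Cathelineau element `ε(a) = a ⊗ a + (1-a) ⊗ (1-a) ∈ k ⊗ kˣ`. -/
noncomputable def eps {k : Type*} [Field k] (a : k) (ha0 : a ≠ 0) (ha1 : a ≠ 1) :
    TensorProduct ℤ k (Additive kˣ) :=
  a ⊗ₜ[ℤ] Additive.ofMul (Units.mk0 a ha0)
    + (1 - a) ⊗ₜ[ℤ] Additive.ofMul (Units.mk0 (1 - a) (sub_ne_zero.mpr (Ne.symm ha1)))

/-- The action `c⋆` of `c ∈ k` on `k ⊗ kˣ`, determined by `c⋆(u ⊗ v) = (c·u) ⊗ v`. -/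
noncomputable def star' {k : Type*} [Field k] (c : k) :
    TensorProduct ℤ k (Additive kˣ) →ₗ[ℤ] TensorProduct ℤ k (Additive kˣ) :=
  LinearMap.rTensor (Additive kˣ) (AddMonoidHom.mulLeft c).toIntLinearMap

theorem star'_tmul {k : Type*} [Field k] (c u : k) (v : Additive kˣ) :
    star' c (u ⊗ₜ[ℤ] v) = (c * u) ⊗ₜ[ℤ] v :=
  rfl

/-- Clearing denominators: `c⋆ε(d/c) = d ⊗ d + (c-d) ⊗ (c-d) - c ⊗ c`. -/
theorem star'_eps_div {k : Type*} [Field k] {c d : k} (hc : c ≠ 0) (hd : d ≠ 0)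
    (hcd : c - d ≠ 0) (h0 : d / c ≠ 0) (h1 : d / c ≠ 1) :
    star' c (eps (d / c) h0 h1) =
      d ⊗ₜ[ℤ] Additive.ofMul (Units.mk0 d hd)
        + (c - d) ⊗ₜ[ℤ] Additive.ofMul (Units.mk0 (c - d) hcd)
        - c ⊗ₜ[ℤ] Additive.ofMul (Units.mk0 c hc) := by
  have hu : Units.mk0 (d / c) h0 = Units.mk0 d hd / Units.mk0 c hc := by
    ext; simp
  have hv : Units.mk0 (1 - d / c) (sub_ne_zero.mpr (Ne.symm h1))
      = Units.mk0 (c - d) hcd / Units.mk0 c hc := by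
    ext; simp [sub_div, hc]
  have hm : c * (d / c) = d := mul_div_cancel₀ d hc
  have hm' : c * (1 - d / c) = c - d := by rw [mul_sub, hm, mul_one]
  rw [eps, map_add, star'_tmul, star'_tmul, hm, hm', hu, hv, ofMul_div, ofMul_div,
    TensorProduct.tmul_sub, TensorProduct.tmul_sub,
    TensorProduct.sub_tmul c d (Additive.ofMul (Units.mk0 c hc))]
  abel

/-- In characteristic different from two, `x ⊗ x + (-x) ⊗ (-x)` vanishes in `k ⊗ kˣ`. -/
theorem tmul_self_add_neg_tmul_neg {k : Type*} [Field k] (h2 : (2 : k) ≠ 0) (u : kˣ) :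
    (u : k) ⊗ₜ[ℤ] Additive.ofMul u + (-u : k) ⊗ₜ[ℤ] Additive.ofMul (-u) = 0 := by
  rw [← neg_one_mul u, ofMul_mul, TensorProduct.tmul_add, tmul_ofMul_neg_one h2,
    TensorProduct.neg_tmul]
  abel

/-- Cathelineau's infinitesimal four-term relation
`ε(a) − ε(b) + a⋆ε(b/a) + (1−a)⋆ε((1−b)/(1−a)) = 0` in `k ⊗ kˣ`. -/
theorem stmt_6 {k : Type*} [Field k] (h2 : (2 : k) ≠ 0) (a b : k)
    (ha0 : a ≠ 0) (ha1 : a ≠ 1) (hb0 : b ≠ 0) (hb1 : b ≠ 1) (hab : a ≠ b) :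
    eps a ha0 ha1 - eps b hb0 hb1
      + star' a (eps (b / a) (div_ne_zero hb0 ha0)
          (fun h => hab ((div_eq_one_iff_eq ha0).mp h).symm))
      + star' (1 - a) (eps ((1 - b) / (1 - a))
          (div_ne_zero (sub_ne_zero.mpr (Ne.symm hb1)) (sub_ne_zero.mpr (Ne.symm ha1)))
          (fun h => hab (by
            rw [div_eq_one_iff_eq (sub_ne_zero.mpr (Ne.symm ha1))] at h
            linear_combination h))) = 0 := by
  have ha1' : 1 - a ≠ 0 := sub_ne_zero.mpr (Ne.symm ha1)
  have hb1' : 1 - b ≠ 0 := sub_ne_zero.mpr (Ne.symm hb1)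
  have hd : a - b ≠ 0 := sub_ne_zero.mpr hab
  have hs : 1 - a - (1 - b) = -(a - b) := by ring
  have hd' : 1 - a - (1 - b) ≠ 0 := hs ▸ neg_ne_zero.mpr hd
  have hw : Units.mk0 (1 - a - (1 - b)) hd' = -Units.mk0 (a - b) hd := by
    ext; exact hs
  have hz := tmul_self_add_neg_tmul_neg h2 (Units.mk0 (a - b) hd)
  rw [Units.val_mk0] at hz
  rw [star'_eps_div ha0 hb0 hd, star'_eps_div ha1' hb1' hd', hw, hs, eps, eps, ← hz]
  abel
end

section
/- Let p be a prime, K a field of characteristic p, β ∈ K with β^p = β + 1, and y ∈ K. Set x := y^p − y and assume x ≠ 0 and x ≠ 1 (so that δ(y) and δ(y+1) are defined). Then δ(y+1)·(1−x)·y^p = δ(y)·x·(β−y)^p; equivalently δ(y+1)/δ(y) = (x/(1−x))·((β−y)/y)^p, so that δ(y+1)/δ(y) ≡ x/(1−x) modulo p-th powers in Kˣ. (This is equation (5.19), in exact form with the explicit p-th power ((β−y)/y)^p.) -/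
open Polynomial in
/-- In characteristic `p`, the product of `z - a` over the prime field is `z ^ p - z`. -/
theorem prod_range_sub_natCast_eq_pow_sub {K : Type*} [Field K] (p : ℕ) (hp : p.Prime) [CharP K p]
    (z : K) : ∏ a ∈ Finset.range p, (z - (a : K)) = z ^ p - z := by
  have : Fact p.Prime := ⟨hp⟩
  suffices h : ∏ a ∈ Finset.range p, (X - C (a : K)) = X ^ p - X by
    simpa [eval_prod] using congrArg (eval z) h
  have hmonic : (∏ a ∈ Finset.range p, (X - C (a : K))).Monic :=
    monic_prod_X_sub_C _ _
  have hdeg : (∏ a ∈ Finset.range p, (X - C (a : K))).degree = (p : WithBot ℕ) := by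
    simp only [degree_prod, degree_X_sub_C, Finset.sum_const, Finset.card_range, nsmul_eq_mul, mul_one]
  have hlt : (X : K[X]).degree < (X ^ p : K[X]).degree := by
    simpa using hp.one_lt
  refine eq_of_degree_sub_lt_of_eval_index_eq (s := Finset.range p) (v := fun a : ℕ => (a : K)) ?_ ?_ ?_
  · intro a ha b hb hab
    exact CharP.natCast_injOn_Iio K p (by simpa using ha) (by simpa using hb) hab
  · have hlead : (X ^ p - X : K[X]).leadingCoeff = 1 := by
      rw [leadingCoeff_sub_of_degree_lt hlt, leadingCoeff_X_pow]
    have hdeg' : (X ^ p - X : K[X]).degree = (p : WithBot ℕ) := by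
      rw [degree_sub_eq_left_of_degree_lt hlt, degree_X_pow]
    rw [Finset.card_range, ← hdeg]
    exact degree_sub_lt_left (hdeg.trans hdeg'.symm) hmonic.ne_zero (hmonic.leadingCoeff.trans hlead.symm)
  · intro a ha
    have hfrob : (a : K) ^ p = a := by
      rw [← frobenius_def, map_natCast]
    simp only [eval_prod, eval_sub, eval_X, eval_C, eval_pow, hfrob, sub_self]
    exact Finset.prod_eq_zero ha (sub_self _)

/-- In characteristic `p`, the product of `z + a` over the prime field is `z ^ p - z`. -/
theorem prod_range_add_natCast_eq_pow_sub {K : Type*} [Field K] (p : ℕ) (hp : p.Prime) [CharP K p]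
    (z : K) : ∏ a ∈ Finset.range p, (z + (a : K)) = z ^ p - z := by
  have : Fact p.Prime := ⟨hp⟩
  have hneg : ∀ w : K, (-w) ^ p = -w ^ p := fun w => by
    simpa [frobenius_def] using map_neg (frobenius K p) w
  have h := prod_range_sub_natCast_eq_pow_sub p hp (-z)
  have hprod : ∏ a ∈ Finset.range p, (-z - (a : K))
      = (-1) ^ p * ∏ a ∈ Finset.range p, (z + (a : K)) := by
    conv_rhs => rw [← Finset.card_range p, ← Finset.prod_const, Finset.card_range,
      ← Finset.prod_mul_distrib]
    exact Finset.prod_congr rfl fun a _ => by ring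
  rw [hprod, hneg, hneg, one_pow] at h
  linear_combination -h

/-- Summation by parts for weighted products. -/
theorem prod_range_pow_shift_mul_prod {M : Type*} [CommMonoid M] (f : ℕ → M) (n : ℕ) :
    (∏ a ∈ Finset.range n, f (a + 1) ^ a) * ∏ a ∈ Finset.range n, f (a + 1)
      = ∏ a ∈ Finset.range (n + 1), f a ^ a := by
  rw [← Finset.prod_mul_distrib, Finset.prod_range_succ', pow_zero, mul_one]
  exact Finset.prod_congr rfl fun a _ => (pow_succ _ _).symm

/-- The factor at `0` of a product with weights `a` is trivial. -/
theorem prod_Icc_one_pow_eq_prod_range {M : Type*} [CommMonoid M] (f : ℕ → M) {n : ℕ} (hn : 0 < n) :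
    ∏ a ∈ Finset.Icc 1 (n - 1), f a ^ a = ∏ a ∈ Finset.range n, f a ^ a := by
  rw [Finset.prod_range_eq_mul_Ico _ hn, pow_zero, one_mul]
  congr 1

/-- Equation (5.19) in exact form: with `x = y^p − y ≠ 0, 1` and
`δ(u) = ∏_{a=1}^{p−1}((β−u−a)/(u+a))^a`, one has
`δ(y+1)·(1−x)·y^p = δ(y)·x·(β−y)^p`, i.e. `δ(y+1)/δ(y) = (x/(1−x))·((β−y)/y)^p`. -/
theorem stmt_12 {K : Type*} [Field K] (p : ℕ) (hp : p.Prime) [CharP K p]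
    (β y : K) (hβ : β ^ p = β + 1)
    (hx0 : y ^ p - y ≠ 0) (hx1 : y ^ p - y ≠ 1) :
    (∏ a ∈ Finset.Icc 1 (p - 1), ((β - (y + 1) - (a : K)) / ((y + 1) + (a : K))) ^ a)
        * (1 - (y ^ p - y)) * y ^ p
      = (∏ a ∈ Finset.Icc 1 (p - 1), ((β - y - (a : K)) / (y + (a : K))) ^ a)
        * (y ^ p - y) * (β - y) ^ p := by
  have : Fact p.Prime := ⟨hp⟩
  set f : ℕ → K := fun a => (β - y - (a : K)) / (y + (a : K)) with hf
  have hshift : ∀ a : ℕ, (β - (y + 1) - (a : K)) / ((y + 1) + (a : K)) = f (a + 1) := fun a => by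
    simp only [hf]
    push_cast
    congr 1 <;> ring
  have hfp : f p = (β - y) / y := by simp [hf]
  have hf0 : f 0 = f p := by simp [hf]
  have hy : y ≠ 0 := by
    rintro rfl
    simp [hp.ne_zero] at hx0
  have hprod : ∏ a ∈ Finset.range p, f (a + 1) = (1 - (y ^ p - y)) / (y ^ p - y) := by
    have hnum : (β - y) ^ p - (β - y) = 1 - (y ^ p - y) := by
      rw [sub_pow_char, hβ]
      ring
    have hfull : ∏ a ∈ Finset.range p, f a = (1 - (y ^ p - y)) / (y ^ p - y) := by
      rw [Finset.prod_div_distrib, prod_range_sub_natCast_eq_pow_sub p hp,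
        prod_range_add_natCast_eq_pow_sub p hp, hnum]
    have hne : f p ≠ 0 := by
      rw [hfp]
      refine div_ne_zero (fun h => hx1 ?_) hy
      rw [h, zero_pow hp.ne_zero] at hnum
      linear_combination hnum
    have h := Finset.prod_range_succ' f p
    rw [Finset.prod_range_succ, hf0] at h
    rw [← hfull, mul_right_cancel₀ hne h]
  have hmain := prod_range_pow_shift_mul_prod f p
  rw [hprod, Finset.prod_range_succ, hfp, div_pow] at hmain
  simp only [hshift]
  rw [prod_Icc_one_pow_eq_prod_range (fun a => f (a + 1)) hp.pos,
    prod_Icc_one_pow_eq_prod_range f hp.pos]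
  rw [← mul_div_assoc, ← mul_div_assoc, div_eq_div_iff hx0 (pow_ne_zero p hy)] at hmain
  linear_combination hmain
end

section
/- Let p be a prime, K a field of characteristic p, and β ∈ K with β^p = β + 1. In the polynomial ring K[Y], set N := ∏_{a=1}^{p−1}(C β − (Y + a))^a and D := ∏_{a=1}^{p−1}(Y + a)^a (indices a cast from ℕ). Then, with ′ denoting the formal derivative, (N′·D − N·D′)·(Y^p − Y)·(1 − Y^p + Y) = (C β·(Y^p − Y) − Y)·N·D. (This is equations (5.17)–(5.18): the logarithmic derivative of δ(y) = ∏_{a=1}^{p−1}((β−(y+a))/(y+a))^a equals η(y) = (β(y^p−y) − y)/((y^p−y)(1−y^p+y)), identifying δ as the canonical trivializing cochain for the Cathelineau element ε(x) in the Artin–Schreier theory.) -/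
open Polynomial

/-- The logarithmic derivative of `∏ fᵢ ^ nᵢ`, with denominators cleared. -/
theorem derivative_prod_pow_mul_prod {R ι : Type*} [CommRing R] [DecidableEq ι] (s : Finset ι)
    (f : ι → R[X]) (n : ι → ℕ) :
    derivative (∏ i ∈ s, f i ^ n i) * ∏ i ∈ s, f i
      = (∏ i ∈ s, f i ^ n i) * ∑ i ∈ s, n i * (∏ j ∈ s.erase i, f j) * derivative (f i) := by
  rw [derivative_prod_finset, Finset.sum_mul, Finset.mul_sum]
  refine Finset.sum_congr rfl fun i hi => ?_
  rw [← Finset.mul_prod_erase s f hi, ← Finset.mul_prod_erase s (fun j => f j ^ n j) hi,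
    derivative_pow]
  rcases n i with _ | m
  · simp
  · simp only [Nat.add_sub_cancel, map_natCast]
    ring

/-- In characteristic `p`, the product of the translates of `X` by the prime field. -/
theorem prod_range_X_add_natCast {K : Type*} [Field K] (p : ℕ) [Fact p.Prime] [CharP K p] :
    ∏ a ∈ Finset.range p, (X + (a : K[X])) = X ^ p - X := by
  have hZ : ∏ a : ZMod p, (X - C a) = (X ^ p - X : (ZMod p)[X]) := by
    have h := FiniteField.X_pow_card_sub_X_natDegree_eq (ZMod p) (Fact.out : p.Prime).one_lt
    have hr := FiniteField.roots_X_pow_card_sub_X (ZMod p)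
    rw [ZMod.card] at hr
    have hm : (X ^ p - X : (ZMod p)[X]).Monic :=
      monic_X_pow_sub (by rw [degree_X]; exact_mod_cast (Fact.out : p.Prime).one_lt)
    have := prod_multiset_X_sub_C_of_monic_of_roots_card_eq hm
      (by rw [h, hr]; simp [ZMod.card])
    rw [hr] at this
    exact this
  have hneg : ∏ a : ZMod p, (X + C a) = (X ^ p - X : (ZMod p)[X]) := by
    rw [← hZ]
    exact Fintype.prod_equiv (Equiv.neg _) _ _ (by simp)
  have hrange : ∏ a ∈ Finset.range p, (X + (a : (ZMod p)[X])) = X ^ p - X := by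
    rw [← hneg]
    refine Finset.prod_bij' (fun a _ => (a : ZMod p)) (fun a _ => a.val) ?_ ?_ ?_ ?_ ?_
    · simp
    · intro a _
      simpa using a.val_lt
    · intro a ha
      exact ZMod.val_cast_of_lt (Finset.mem_range.mp ha)
    · simp
    · simp
  have := congrArg (map (ZMod.castHom dvd_rfl K)) hrange
  simpa [Polynomial.map_prod] using this

/-- The logarithmic derivative of `∏ (X + a) ^ a` over the prime field is `X / (X ^ p - X)`. -/
theorem derivative_prod_X_add_natCast_pow {K : Type*} [Field K] (p : ℕ) [Fact p.Prime]
    [CharP K p] :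
    derivative (∏ a ∈ Finset.range p, (X + (a : K[X])) ^ a) * (X ^ p - X)
      = (∏ a ∈ Finset.range p, (X + (a : K[X])) ^ a) * X := by
  have hP := prod_range_X_add_natCast (K := K) p
  have hP' : ∑ a ∈ Finset.range p, ∏ b ∈ (Finset.range p).erase a, (X + (b : K[X])) = -1 := by
    have := congrArg derivative hP
    rw [derivative_prod_finset] at this
    simpa [derivative_X_pow] using this
  have h := derivative_prod_pow_mul_prod (Finset.range p) (fun a : ℕ => X + (a : K[X])) id
  simp only [id] at h
  rw [hP] at h
  rw [h]
  congr 1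
  calc _ = ∑ a ∈ Finset.range p, ((X ^ p - X : K[X])
          - X * ∏ b ∈ (Finset.range p).erase a, (X + (b : K[X]))) := by
        refine Finset.sum_congr rfl fun a ha => ?_
        rw [← hP, ← Finset.mul_prod_erase _ _ ha]
        simp only [derivative_add, derivative_X, derivative_natCast]
        ring
    _ = X := by
        rw [Finset.sum_sub_distrib, ← Finset.mul_sum, hP']
        simp

theorem prod_Icc_pow_self_eq_prod_range {M : Type*} [CommMonoid M] {p : ℕ} (hp : 0 < p)
    (f : ℕ → M) : ∏ a ∈ Finset.Icc 1 (p - 1), f a ^ a = ∏ a ∈ Finset.range p, f a ^ a := by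
  refine Finset.prod_subset (fun a ha => ?_) fun a ha ha' => ?_
  · simp only [Finset.mem_Icc, Finset.mem_range] at *
    omega
  · simp only [Finset.mem_Icc, Finset.mem_range] at *
    obtain rfl : a = 0 := by omega
    exact pow_zero _

/-- Equations (5.17)–(5.18): with `N = ∏_{a=1}^{p−1}(β − (Y + a))^a` and
`D = ∏_{a=1}^{p−1}(Y + a)^a` in `K[Y]`, the logarithmic derivative of `N/D` equals
`η = (β(Y^p−Y) − Y)/((Y^p−Y)(1−Y^p+Y))`, i.e.
`(N′D − ND′)·(Y^p − Y)·(1 − Y^p + Y) = (β·(Y^p − Y) − Y)·N·D`. -/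
theorem stmt_14 {K : Type*} [Field K] (p : ℕ) (hp : p.Prime) [CharP K p]
    (β : K) (hβ : β ^ p = β + 1) :
    (derivative (∏ a ∈ Finset.Icc 1 (p - 1), (C β - (X + (a : K[X]))) ^ a)
          * (∏ a ∈ Finset.Icc 1 (p - 1), (X + (a : K[X])) ^ a)
        - (∏ a ∈ Finset.Icc 1 (p - 1), (C β - (X + (a : K[X]))) ^ a)
          * derivative (∏ a ∈ Finset.Icc 1 (p - 1), (X + (a : K[X])) ^ a))
        * (X ^ p - X) * (1 - X ^ p + X)
      = (C β * (X ^ p - X) - X)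
          * (∏ a ∈ Finset.Icc 1 (p - 1), (C β - (X + (a : K[X]))) ^ a)
          * (∏ a ∈ Finset.Icc 1 (p - 1), (X + (a : K[X])) ^ a) := by
  have : Fact p.Prime := ⟨hp⟩
  rw [prod_Icc_pow_self_eq_prod_range hp.pos fun a => C β - (X + (a : K[X])),
    prod_Icc_pow_self_eq_prod_range hp.pos fun a => X + (a : K[X])]
  have hD := derivative_prod_X_add_natCast_pow (K := K) p
  set D : K[X] := ∏ a ∈ Finset.range p, (X + (a : K[X])) ^ a
  have hN : ∏ a ∈ Finset.range p, (C β - (X + (a : K[X]))) ^ a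
      = C (∏ a ∈ Finset.range p, (-1) ^ a) * D.comp (X - C β) := by
    rw [map_prod, Polynomial.prod_comp, ← Finset.prod_mul_distrib]
    refine Finset.prod_congr rfl fun a _ => ?_
    simp only [map_pow, map_neg, map_one, pow_comp, add_comp, X_comp, natCast_comp]
    rw [← mul_pow]
    ring
  have hDβ := congrArg (fun f => f.comp (X - C β)) hD
  have hfrob : (X - C β : K[X]) ^ p = X ^ p - (C β + 1) := by
    rw [sub_pow_char, ← C_pow, hβ, C_add, C_1]
  simp only [mul_comp, sub_comp, pow_comp, X_comp, hfrob] at hDβ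
  rw [hN, derivative_C_mul, derivative_comp, derivative_sub, derivative_X, derivative_C]
  linear_combination
    (-C (∏ a ∈ Finset.range p, (-1) ^ a) * D * (X ^ p - X)) * hDβ
      - C (∏ a ∈ Finset.range p, (-1) ^ a) * D.comp (X - C β) * (1 - X ^ p + X) * hD
end
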